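/- Let p and q be distinct participants, ℓ and ℓ' labels, and S a sort, and let T be the infinite SISO tree satisfying T = p?ℓ(S).T (the unfolding of μt.p?ℓ.t). Then T does not refine q?ℓ'(S).T, i.e., ¬(T ≲ q?ℓ'(S).T); the action-set side condition in rule [𝒜] rules out the would-be coinductive derivation, since act(T) = {p?} while act(q?ℓ'(S).T) = {q?, p?}. -/

import Mathlib

/-- A single action of a SISO tree: an input from `p` or an output to `p`,
with label `l` and payload sort `s`. -/
inductive Act (P L S : Type) : Type
  | inp (p : P) (l : L) (s : S)
  | out (p : P) (l : L) (s : S)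

/-- A SISO tree is a possibly infinite sequence of actions; `Seq.nil` is `end`. -/
abbrev SISO (P L S : Type) : Type := Stream'.Seq (Act P L S)

/-- Prepend a finite list of actions to a SISO tree. -/
def prepend {P L S : Type} (A : List (Act P L S)) (W : SISO P L S) : SISO P L S :=
  A.foldr Stream'.Seq.cons W

/-- The (participant, direction) action of a term: `(p, true)` for `p?`, `(p, false)` for `p!`. -/
def actOf {P L S : Type} : Act P L S → P × Bool
  | Act.inp p _ _ => (p, true)
  | Act.out p _ _ => (p, false)

/-- `act(W)`: the set of input/output actions occurring in the tree `W`. -/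
def acts {P L S : Type} (W : SISO P L S) : Set (P × Bool) :=
  { a | ∃ (n : ℕ) (t : Act P L S), W.get? n = some t ∧ actOf t = a }

/-- An `𝒜^p`-context: a nonempty finite sequence of input actions from participants `q ≠ p`. -/
def ACtx {P L S : Type} (p : P) (A : List (Act P L S)) : Prop :=
  A ≠ [] ∧ ∀ t ∈ A, ∃ q l s, t = Act.inp q l s ∧ q ≠ p

/-- A `ℬ^p`-context: a nonempty finite sequence of actions in which every output
is to a participant `q ≠ p`. -/
def BCtx {P L S : Type} (p : P) (B : List (Act P L S)) : Prop :=
  B ≠ [] ∧ ∀ t ∈ B, ∀ q l s, t = Act.out q l s → q ≠ p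

/-- One step of the tree refinement rules `[end]`, `[in]`, `[out]`, `[𝒜]`, `[ℬ]`,
with coinductive premises taken from the relation `R`. -/
inductive Step {P L S : Type} (le : S → S → Prop)
    (R : SISO P L S → SISO P L S → Prop) : SISO P L S → SISO P L S → Prop
  | end_ : Step le R Stream'.Seq.nil Stream'.Seq.nil
  | inp {p : P} {l : L} {s s' : S} {W W' : SISO P L S} :
      le s' s → R W W' →
      Step le R (Stream'.Seq.cons (Act.inp p l s) W) (Stream'.Seq.cons (Act.inp p l s') W')
  | out {p : P} {l : L} {s s' : S} {W W' : SISO P L S} :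
      le s s' → R W W' →
      Step le R (Stream'.Seq.cons (Act.out p l s) W) (Stream'.Seq.cons (Act.out p l s') W')
  | ctxA {p : P} {l : L} {s s' : S} {W W' : SISO P L S} {A : List (Act P L S)} :
      le s' s → ACtx p A → R W (prepend A W') → acts W = acts (prepend A W') →
      Step le R (Stream'.Seq.cons (Act.inp p l s) W)
        (prepend A (Stream'.Seq.cons (Act.inp p l s') W'))
  | ctxB {p : P} {l : L} {s s' : S} {W W' : SISO P L S} {B : List (Act P L S)} :
      le s s' → BCtx p B → R W (prepend B W') → acts W = acts (prepend B W') →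
      Step le R (Stream'.Seq.cons (Act.out p l s) W)
        (prepend B (Stream'.Seq.cons (Act.out p l s') W'))

/-- The tree refinement relation `≲`: the greatest relation closed under the rules,
i.e. the union of all post-fixpoints of `Step le`. -/
def Refines {P L S : Type} (le : S → S → Prop) (W W' : SISO P L S) : Prop :=
  ∃ R : SISO P L S → SISO P L S → Prop,
    (∀ a b, R a b → Step le R a b) ∧ R W W'

theorem acts_cons {P L S : Type} (t : Act P L S) (W : SISO P L S) :
    acts (Stream'.Seq.cons t W) = insert (actOf t) (acts W) := by
  ext a
  constructor
  · rintro ⟨n, u, hu, rfl⟩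
    cases n with
    | zero =>
      rw [Stream'.Seq.get?_cons_zero, Option.some_inj] at hu
      exact Or.inl (congrArg actOf hu.symm)
    | succ n => exact Or.inr ⟨n, u, by rwa [Stream'.Seq.get?_cons_succ] at hu, rfl⟩
  · rintro (rfl | ⟨n, u, hu, rfl⟩)
    · exact ⟨0, t, Stream'.Seq.get?_cons_zero t W, rfl⟩
    · exact ⟨n + 1, u, by rwa [Stream'.Seq.get?_cons_succ], rfl⟩

theorem acts_const_subset {P L S : Type} (t : Act P L S) :
    acts (Stream'.Seq.ofStream (Stream'.const t)) ⊆ {actOf t} := by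
  rintro _ ⟨n, u, hu, rfl⟩
  exact congrArg actOf (Option.some_inj.mp hu.symm)

theorem ofStream_const {α : Type*} (a : α) :
    Stream'.Seq.ofStream (Stream'.const a) =
      Stream'.Seq.cons a (Stream'.Seq.ofStream (Stream'.const a)) := by
  rw [← Stream'.Seq.ofStream_cons, ← Stream'.const_eq]

theorem stmt7 {P L S : Type} (le : S → S → Prop)
    (p q : P) (hpq : p ≠ q) (l l' : L) (s : S) :
    ¬ Refines le
        (Stream'.Seq.ofStream (Stream'.const (Act.inp p l s)))
        (Stream'.Seq.cons (Act.inp q l' s)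
          (Stream'.Seq.ofStream (Stream'.const (Act.inp p l s)))) := by
  rintro ⟨R, hR, h⟩
  have hstep := hR _ _ h
  have hT := acts_const_subset (Act.inp p l s)
  rw [ofStream_const (Act.inp p l s)] at hstep
  generalize Stream'.Seq.ofStream (Stream'.const (Act.inp p l s)) = T at hstep hT
  generalize hX : Stream'.Seq.cons (Act.inp p l s) T = X at hstep
  generalize hY : Stream'.Seq.cons (Act.inp q l' s) _ = Y at hstep
  cases hstep with
  | end_ => exact Stream'.Seq.cons_ne_nil hX
  | inp _ _ =>
    obtain ⟨hx, -⟩ := Stream'.Seq.cons_eq_cons.mp hX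
    obtain ⟨hy, -⟩ := Stream'.Seq.cons_eq_cons.mp hY
    cases hx
    cases hy
    exact hpq rfl
  | out _ _ => cases (Stream'.Seq.cons_eq_cons.mp hX).1
  | @ctxA _ _ _ _ W W' A _ hA _ hacts =>
    obtain ⟨-, rfl⟩ := Stream'.Seq.cons_eq_cons.mp hX
    cases A with
    | nil => exact hA.1 rfl
    | cons t A =>
      obtain ⟨rfl, -⟩ := Stream'.Seq.cons_eq_cons.mp hY
      have hq : actOf (Act.inp q l' s) ∈ acts T := by
        rw [hacts]
        change _ ∈ acts (Stream'.Seq.cons _ (prepend A W'))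
        rw [acts_cons]
        exact Set.mem_insert _ _
      exact hpq (congrArg Prod.fst (hT hq)).symm
  | ctxB _ _ _ _ => cases (Stream'.Seq.cons_eq_cons.mp hX).1
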